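/- arXiv:1804.00391 — 2 statements merged into one kernel-verified Lean document; each statement's English description precedes it below -/
import Mathlib

section
/- Suppose pa > C_e − C0 for every e ∈ E (no vulnerable facilities). Then (σd, σa) is a Nash equilibrium of the normal-form game Γ if and only if σa(∅) = 1 (so σa(e) = 0 for all e ∈ E) and the security effort vector induced by σd is identically 0. -/
open Finset

noncomputable section

namespace SecGame

variable {E : Type*} [Fintype E] [DecidableEq E]

/-- Usage cost after the attacker–defender interaction. -/
def usageCost (C0 : ℝ) (Ce : E → ℝ) (sd : Finset E) : Option E → ℝ
  | some e => if e ∈ sd then C0 else Ce e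
  | none => C0

/-- Defender mixed strategy over subsets of facilities. -/
def IsDefMixed (σd : Finset E → ℝ) : Prop :=
  (∀ sd, 0 ≤ σd sd) ∧ ∑ sd : Finset E, σd sd = 1

/-- Attacker mixed strategy over `E ∪ {∅}`. -/
def IsAtkMixed (σa : Option E → ℝ) : Prop :=
  (∀ sa, 0 ≤ σa sa) ∧ ∑ sa : Option E, σa sa = 1

/-- Defender expected utility. -/
def Ud (C0 : ℝ) (Ce : E → ℝ) (pd : ℝ) (σd : Finset E → ℝ) (σa : Option E → ℝ) : ℝ :=
  ∑ sd : Finset E, ∑ sa : Option E,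
    σd sd * σa sa * (-(usageCost C0 Ce sd sa) - pd * (sd.card : ℝ))

/-- Attacker expected utility. -/
def Ua (C0 : ℝ) (Ce : E → ℝ) (pa : ℝ) (σd : Finset E → ℝ) (σa : Option E → ℝ) : ℝ :=
  ∑ sd : Finset E, ∑ sa : Option E,
    σd sd * σa sa * (usageCost C0 Ce sd sa - pa * (if sa = none then 0 else 1))

/-- Security effort vector induced by a defender mixed strategy. -/
def effort (σd : Finset E → ℝ) (e : E) : ℝ :=
  ∑ sd ∈ Finset.univ.filter (fun sd => e ∈ sd), σd sd

/-- Nash equilibrium of the normal form game Γ. -/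
def IsNE (C0 : ℝ) (Ce : E → ℝ) (pa pd : ℝ) (σd : Finset E → ℝ) (σa : Option E → ℝ) : Prop :=
  IsDefMixed σd ∧ IsAtkMixed σa ∧
  (∀ σd', IsDefMixed σd' → Ud C0 Ce pd σd' σa ≤ Ud C0 Ce pd σd σa) ∧
  (∀ σa', IsAtkMixed σa' → Ua C0 Ce pa σd σa' ≤ Ua C0 Ce pa σd σa)

/-- Security effort vectors in the unit box `[0,1]^E`. -/
def InBox (ρ : E → ℝ) : Prop := ∀ e, 0 ≤ ρ e ∧ ρ e ≤ 1

/-- Defender expected utility as a function of the security effort vector. -/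
def UdRho (C0 : ℝ) (Ce : E → ℝ) (pd : ℝ) (ρ : E → ℝ) (σa : Option E → ℝ) : ℝ :=
  -(∑ e : E, (ρ e * ((C0 - Ce e) * σa (some e) + pd) + Ce e * σa (some e))) - C0 * σa none

/-- Attacker expected utility as a function of the security effort vector. -/
def UaRho (C0 : ℝ) (Ce : E → ℝ) (pa : ℝ) (ρ : E → ℝ) (σa : Option E → ℝ) : ℝ :=
  (∑ e : E, (ρ e * (C0 - Ce e) * σa (some e) + Ce e * σa (some e))) + C0 * σa none
    - pa * ∑ e : E, σa (some e)

/-- Threshold security effort for a vulnerable facility. -/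
def rhoHat (C0 : ℝ) (Ce : E → ℝ) (pa : ℝ) (e : E) : ℝ := (Ce e - pa - C0) / (Ce e - C0)

/-- Subgame perfect equilibrium of the sequential game Γ̃. -/
def IsSPE (C0 : ℝ) (Ce : E → ℝ) (pa pd : ℝ) (ρstar : E → ℝ)
    (σastar : (E → ℝ) → Option E → ℝ) : Prop :=
  InBox ρstar ∧
  (∀ ρ, InBox ρ → IsAtkMixed (σastar ρ) ∧
    ∀ σa, IsAtkMixed σa → UaRho C0 Ce pa ρ σa ≤ UaRho C0 Ce pa ρ (σastar ρ)) ∧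
  (∀ ρ, InBox ρ → UdRho C0 Ce pd ρ (σastar ρ) ≤ UdRho C0 Ce pd ρstar (σastar ρstar))

omit [Fintype E] in
theorem usageCost_sub_lt {C0 pa : ℝ} {Ce : E → ℝ} (hpa : 0 < pa)
    (hreg : ∀ e : E, Ce e - C0 < pa) (sd : Finset E) (e : E) :
    usageCost C0 Ce sd (some e) - pa < C0 := by
  have := hreg e
  simp only [usageCost]
  split_ifs <;> linarith

theorem isDefMixed_single_empty : IsDefMixed (Pi.single (∅ : Finset E) (1 : ℝ)) :=
  ⟨fun sd => by by_cases h : sd = ∅ <;> simp [h], by simp⟩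

theorem isAtkMixed_single_none : IsAtkMixed (Pi.single (none : Option E) (1 : ℝ)) :=
  ⟨fun sa => by by_cases h : sa = none <;> simp [h], by simp⟩

/-- The attacker's loss relative to not attacking. -/
theorem sub_Ua (C0 : ℝ) (Ce : E → ℝ) (pa : ℝ) {σd : Finset E → ℝ} {σa : Option E → ℝ}
    (hd : IsDefMixed σd) (ha : IsAtkMixed σa) :
    C0 - Ua C0 Ce pa σd σa =
      ∑ e : E, σa (some e) *
        ∑ sd : Finset E, σd sd * (C0 - (usageCost C0 Ce sd (some e) - pa)) := by
  have hC : C0 = ∑ sd : Finset E, ∑ sa : Option E, σd sd * σa sa * C0 := by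
    simp_rw [← Finset.sum_mul, ← Finset.mul_sum, ← Finset.sum_mul, ha.2, mul_one, hd.2, one_mul]
  calc C0 - Ua C0 Ce pa σd σa
      = ∑ sd : Finset E, ∑ sa : Option E, σd sd * σa sa *
          (C0 - (usageCost C0 Ce sd sa - pa * (if sa = none then 0 else 1))) := by
        nth_rewrite 1 [hC]
        simp only [Ua, mul_sub, Finset.sum_sub_distrib]
    _ = ∑ sd : Finset E, ∑ e : E, σd sd * σa (some e) *
          (C0 - (usageCost C0 Ce sd (some e) - pa)) := by
        simp [Fintype.sum_option, usageCost]
    _ = _ := by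
        rw [Finset.sum_comm]
        refine Finset.sum_congr rfl fun e _ => ?_
        rw [Finset.mul_sum]
        exact Finset.sum_congr rfl fun sd _ => by ring

omit [DecidableEq E] in
theorem sum_mul_pos_of_isDefMixed {σd : Finset E → ℝ} (hd : IsDefMixed σd)
    {f : Finset E → ℝ} (hf : ∀ sd, 0 < f sd) : 0 < ∑ sd : Finset E, σd sd * f sd := by
  have hne : ∃ sd ∈ (Finset.univ : Finset (Finset E)), σd sd ≠ 0 :=
    Finset.exists_ne_zero_of_sum_ne_zero (by rw [hd.2]; exact one_ne_zero)
  obtain ⟨sd, _, h⟩ := hne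
  exact Finset.sum_pos' (fun t _ => mul_nonneg (hd.1 t) (hf t).le)
    ⟨sd, Finset.mem_univ _, mul_pos (lt_of_le_of_ne (hd.1 sd) h.symm) (hf sd)⟩

/-- The defender's utility when there is no attack. -/
theorem Ud_of_no_attack (C0 : ℝ) (Ce : E → ℝ) (pd : ℝ) {σd : Finset E → ℝ} {σa : Option E → ℝ}
    (hd : IsDefMixed σd) (hnone : σa none = 1) (hsome : ∀ e, σa (some e) = 0) :
    Ud C0 Ce pd σd σa = -C0 - pd * ∑ sd : Finset E, σd sd * (sd.card : ℝ) := by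
  have hC : ∑ sd : Finset E, σd sd * (-C0) = -C0 := by rw [← Finset.sum_mul, hd.2, one_mul]
  rw [← hC, Finset.mul_sum, ← Finset.sum_sub_distrib]
  refine Finset.sum_congr rfl fun sd _ => ?_
  simp only [Fintype.sum_option, hnone, hsome, usageCost, mul_zero, zero_mul,
    Finset.sum_const_zero]
  ring

/-- The expected number of defended facilities is the total security effort. -/
theorem sum_card_eq_sum_effort (σd : Finset E → ℝ) :
    ∑ sd : Finset E, σd sd * (sd.card : ℝ) = ∑ e : E, effort σd e := by
  simp only [effort, Finset.sum_filter]
  rw [Finset.sum_comm]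
  refine Finset.sum_congr rfl fun sd _ => ?_
  simp [mul_comm]

theorem effort_nonneg {σd : Finset E → ℝ} (hd : IsDefMixed σd) (e : E) : 0 ≤ effort σd e :=
  Finset.sum_nonneg fun sd _ => hd.1 sd

/-- **Theorem 1, regime Λ⁰ (no vulnerable facilities).**
If `pa > C_e − C0` for every facility `e`, then `(σd, σa)` is a Nash equilibrium of Γ
iff `σa(∅) = 1` (so `σa(e) = 0` for all `e`) and the induced security effort vector is
identically `0`. -/
theorem NE_iff_no_attack_regime {E : Type*} [Fintype E] [DecidableEq E] [Nonempty E]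
    (C0 : ℝ) (Ce : E → ℝ) (pa pd : ℝ) (hpa : 0 < pa) (hpd : 0 < pd)
    (hreg : ∀ e : E, Ce e - C0 < pa)
    (σd : Finset E → ℝ) (σa : Option E → ℝ) :
    IsNE C0 Ce pa pd σd σa ↔
      (IsDefMixed σd ∧ IsAtkMixed σa ∧
       σa none = 1 ∧ (∀ e : E, σa (some e) = 0) ∧
       (∀ e : E, effort σd e = 0)) := by
  have gap_pos (hd : IsDefMixed σd) (e : E) :
      0 < ∑ sd : Finset E, σd sd * (C0 - (usageCost C0 Ce sd (some e) - pa)) :=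
    sum_mul_pos_of_isDefMixed hd fun sd => sub_pos.2 (usageCost_sub_lt hpa hreg sd e)
  constructor
  · rintro ⟨hd, ha, hDef, hAtk⟩
    have hsome : ∀ e : E, σa (some e) = 0 := by
      have h0 := sub_Ua C0 Ce pa hd isAtkMixed_single_none
      have h1 := sub_Ua C0 Ce pa hd ha
      have h2 := hAtk _ isAtkMixed_single_none
      simp only [Pi.single_apply, reduceCtorEq, if_false, zero_mul,
        Finset.sum_const_zero] at h0
      have hnn : ∀ e ∈ (Finset.univ : Finset E), 0 ≤ σa (some e) *
          ∑ sd : Finset E, σd sd * (C0 - (usageCost C0 Ce sd (some e) - pa)) :=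
        fun e _ => mul_nonneg (ha.1 _) (gap_pos hd e).le
      have hz := (Finset.sum_eq_zero_iff_of_nonneg hnn).1
        (le_antisymm (by linarith) (Finset.sum_nonneg hnn))
      exact fun e => (mul_eq_zero.1 (hz e (Finset.mem_univ e))).resolve_right (gap_pos hd e).ne'
    have hnone : σa none = 1 := by
      simpa [Fintype.sum_option, hsome] using ha.2
    refine ⟨hd, ha, hnone, hsome, ?_⟩
    have h := hDef _ isDefMixed_single_empty
    rw [Ud_of_no_attack C0 Ce pd hd hnone hsome,
      Ud_of_no_attack C0 Ce pd isDefMixed_single_empty hnone hsome] at h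
    have hzero : ∑ sd : Finset E, (Pi.single (∅ : Finset E) (1 : ℝ) : Finset E → ℝ) sd *
        (sd.card : ℝ) = 0 := by
      simp [Pi.single_apply]
    rw [hzero, sum_card_eq_sum_effort] at h
    have hle : ∑ e : E, effort σd e ≤ 0 :=
      nonpos_of_mul_nonpos_right (by linarith) hpd
    have hz := (Finset.sum_eq_zero_iff_of_nonneg fun e _ => effort_nonneg hd e).1
      (le_antisymm hle (Finset.sum_nonneg fun e _ => effort_nonneg hd e))
    exact fun e => hz e (Finset.mem_univ e)
  · rintro ⟨hd, ha, hnone, hsome, heff⟩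
    refine ⟨hd, ha, fun σd' hd' => ?_, fun σa' ha' => ?_⟩
    · rw [Ud_of_no_attack C0 Ce pd hd hnone hsome, Ud_of_no_attack C0 Ce pd hd' hnone hsome,
        sum_card_eq_sum_effort σd, sum_card_eq_sum_effort σd']
      have := mul_nonneg hpd.le
        (Finset.sum_nonneg fun e (_ : e ∈ Finset.univ) => effort_nonneg hd' e)
      simp only [heff, Finset.sum_const_zero, mul_zero]
      linarith
    · have h0 := sub_Ua C0 Ce pa hd ha
      have h1 := sub_Ua C0 Ce pa hd ha'
      simp only [hsome, zero_mul, Finset.sum_const_zero] at h0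
      have := Finset.sum_nonneg fun e (_ : e ∈ (Finset.univ : Finset E)) =>
        mul_nonneg (ha'.1 (some e)) (gap_pos hd e).le
      linarith

end SecGame
end
end

section
/- Assume V ≠ ∅, pa ≠ C_e − C0 for every e ∈ E, and ∑_{e∈V} pd/(C_e−C0) < 1 (type I regime). Then an SPE of the sequential game Γ̃ exists, and in every SPE (ρ*, σa*(·)): ρ*_e = ρ̂_e = (C_e−pa−C0)/(C_e−C0) for every e ∈ V, ρ*_e = 0 for every e ∉ V, and the attacker is fully deterred on path, i.e., σa*(∅, ρ*) = 1. -/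
open Finset

noncomputable section

namespace SecGame

variable {E : Type*} [Fintype E] [DecidableEq E]

/-- Gain of the attacker from attacking `e` rather than not attacking. -/
def attackGain (C0 : ℝ) (Ce : E → ℝ) (pa : ℝ) (ρ : E → ℝ) (e : E) : ℝ :=
  (Ce e - C0) * (1 - ρ e) - pa

/-- The effort vector with the threshold effort on vulnerable facilities and `0` elsewhere. -/
def thresholdEffort (C0 : ℝ) (Ce : E → ℝ) (pa : ℝ) (e : E) : ℝ :=
  if C0 < Ce e - pa then rhoHat C0 Ce pa e else 0

/-- `σa` is a best response of the attacker to the effort vector `ρ`. -/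
def IsBestResponse (C0 : ℝ) (Ce : E → ℝ) (pa : ℝ) (ρ : E → ℝ) (σa : Option E → ℝ) : Prop :=
  IsAtkMixed σa ∧ ∀ σa', IsAtkMixed σa' → UaRho C0 Ce pa ρ σa' ≤ UaRho C0 Ce pa ρ σa

lemma isAtkMixed_single (sa : Option E) : IsAtkMixed (Pi.single sa (1 : ℝ)) := by
  refine ⟨fun sa' => ?_, by simp⟩
  by_cases h : sa' = sa
  · subst h; simp
  · simp [h]

lemma IsAtkMixed.none_add_sum {σa : Option E → ℝ} (h : IsAtkMixed σa) :
    σa none + ∑ e, σa (some e) = 1 := by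
  rw [← Fintype.sum_option]; exact h.2

lemma UaRho_eq (C0 : ℝ) (Ce : E → ℝ) (pa : ℝ) (ρ : E → ℝ) {σa : Option E → ℝ}
    (h : IsAtkMixed σa) :
    UaRho C0 Ce pa ρ σa = C0 + ∑ e, σa (some e) * attackGain C0 Ce pa ρ e := by
  have h1 : σa none = 1 - ∑ e, σa (some e) := by linarith [h.none_add_sum]
  have h2 : ∑ e, σa (some e) * attackGain C0 Ce pa ρ e =
      ∑ e, (ρ e * (C0 - Ce e) * σa (some e) + Ce e * σa (some e))
        - C0 * ∑ e, σa (some e) - pa * ∑ e, σa (some e) := by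
    simp only [mul_sum, ← sum_sub_distrib]
    exact sum_congr rfl fun e _ => by unfold attackGain; ring
  rw [h2, UaRho, h1]; ring

lemma UdRho_eq (C0 : ℝ) (Ce : E → ℝ) (pa pd : ℝ) (ρ : E → ℝ) (σa : Option E → ℝ) :
    UdRho C0 Ce pd ρ σa =
      -UaRho C0 Ce pa ρ σa - pd * ∑ e, ρ e - pa * ∑ e, σa (some e) := by
  have h : ∑ e, (ρ e * ((C0 - Ce e) * σa (some e) + pd) + Ce e * σa (some e)) =
      ∑ e, (ρ e * (C0 - Ce e) * σa (some e) + Ce e * σa (some e)) + pd * ∑ e, ρ e := by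
    rw [mul_sum, ← sum_add_distrib]
    exact sum_congr rfl fun e _ => by ring
  rw [UdRho, UaRho, h]; ring

lemma UaRho_single_none (C0 : ℝ) (Ce : E → ℝ) (pa : ℝ) (ρ : E → ℝ) :
    UaRho C0 Ce pa ρ (Pi.single none 1) = C0 := by
  simp [UaRho_eq C0 Ce pa ρ (isAtkMixed_single none)]

lemma UaRho_single_some (C0 : ℝ) (Ce : E → ℝ) (pa : ℝ) (ρ : E → ℝ) (e : E) :
    UaRho C0 Ce pa ρ (Pi.single (some e) 1) = C0 + attackGain C0 Ce pa ρ e := by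
  simp [UaRho_eq C0 Ce pa ρ (isAtkMixed_single (some e)), Pi.single_apply]

lemma isBestResponse_single_none {C0 : ℝ} {Ce : E → ℝ} {pa : ℝ} {ρ : E → ℝ}
    (h : ∀ e, attackGain C0 Ce pa ρ e ≤ 0) :
    IsBestResponse C0 Ce pa ρ (Pi.single none 1) := by
  refine ⟨isAtkMixed_single none, fun σa hσ => ?_⟩
  rw [UaRho_single_none, UaRho_eq C0 Ce pa ρ hσ]
  have := sum_nonpos fun e (_ : e ∈ univ) =>
    mul_nonpos_of_nonneg_of_nonpos (hσ.1 (some e)) (h e)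
  linarith

lemma exists_isBestResponse (C0 : ℝ) (Ce : E → ℝ) (pa : ℝ) (ρ : E → ℝ) :
    ∃ σa, IsBestResponse C0 Ce pa ρ σa := by
  by_cases h : ∀ e, attackGain C0 Ce pa ρ e ≤ 0
  · exact ⟨_, isBestResponse_single_none h⟩
  push Not at h
  obtain ⟨e₀, h₀⟩ := h
  have : Nonempty E := ⟨e₀⟩
  obtain ⟨e, he⟩ := Finite.exists_max (attackGain C0 Ce pa ρ)
  refine ⟨Pi.single (some e) 1, isAtkMixed_single _, fun σa hσ => ?_⟩
  rw [UaRho_single_some, UaRho_eq C0 Ce pa ρ hσ]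
  have h1 : ∑ e', σa (some e') * attackGain C0 Ce pa ρ e' ≤
      (∑ e', σa (some e')) * attackGain C0 Ce pa ρ e := by
    rw [sum_mul]
    exact sum_le_sum fun e' _ => mul_le_mul_of_nonneg_left (he e') (hσ.1 _)
  have h2 : ∑ e', σa (some e') ≤ 1 := by linarith [hσ.none_add_sum, hσ.1 none]
  nlinarith [he e₀]

lemma IsBestResponse.none_eq_one {C0 : ℝ} {Ce : E → ℝ} {pa : ℝ} {ρ : E → ℝ}
    {σa : Option E → ℝ} (h : IsBestResponse C0 Ce pa ρ σa)
    (hneg : ∀ e, attackGain C0 Ce pa ρ e < 0) : σa none = 1 := by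
  have h1 := h.2 _ (isAtkMixed_single none)
  rw [UaRho_single_none, UaRho_eq C0 Ce pa ρ h.1] at h1
  have hle : ∀ e ∈ univ, σa (some e) * attackGain C0 Ce pa ρ e ≤ 0 := fun e _ =>
    mul_nonpos_of_nonneg_of_nonpos (h.1.1 _) (hneg e).le
  have h2 := (sum_eq_zero_iff_of_nonpos hle).1 (le_antisymm (sum_nonpos hle) (by linarith))
  have h3 : ∑ e, σa (some e) = 0 := sum_eq_zero fun e he =>
    (mul_eq_zero.1 (h2 e he)).resolve_right (hneg e).ne
  linarith [h.1.none_add_sum]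

lemma thresholdEffort_le {C0 : ℝ} {Ce : E → ℝ} {pa : ℝ} (hpa : 0 < pa) {ρ : E → ℝ} {m : ℝ}
    (e : E) (h0 : 0 ≤ ρ e) (hm : attackGain C0 Ce pa ρ e ≤ m) :
    thresholdEffort C0 Ce pa e ≤ ρ e + if C0 < Ce e - pa then m / (Ce e - C0) else 0 := by
  unfold thresholdEffort
  split_ifs with hv
  · have hd : 0 < Ce e - C0 := by linarith
    unfold rhoHat attackGain at *
    rw [div_le_iff₀ hd, add_mul, div_mul_cancel₀ _ hd.ne']
    linarith
  · simpa using h0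

lemma mul_sum_thresholdEffort_le {C0 : ℝ} {Ce : E → ℝ} {pa pd : ℝ} (hpa : 0 < pa)
    (hpd : 0 < pd) {ρ : E → ℝ} {m : ℝ} (h0 : ∀ e, 0 ≤ ρ e)
    (hm : ∀ e, attackGain C0 Ce pa ρ e ≤ m) :
    pd * ∑ e, thresholdEffort C0 Ce pa e ≤ pd * ∑ e, ρ e +
      m * ∑ e ∈ univ.filter (fun e => C0 < Ce e - pa), pd / (Ce e - C0) := by
  have h := sum_le_sum fun e (_ : e ∈ univ) => thresholdEffort_le hpa e (h0 e) (hm e)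
  rw [sum_add_distrib, ← sum_filter] at h
  have h' := mul_le_mul_of_nonneg_left h hpd.le
  rw [mul_add, mul_sum (f := fun e => m / (Ce e - C0))] at h'
  refine h'.trans_eq (congrArg _ ?_)
  rw [mul_sum]
  exact sum_congr rfl fun e _ => by ring

lemma thresholdEffort_inBox {C0 : ℝ} (Ce : E → ℝ) {pa : ℝ} (hpa : 0 < pa) :
    InBox (thresholdEffort C0 Ce pa) := by
  intro e
  unfold thresholdEffort rhoHat
  split_ifs with hv
  · have hd : 0 < Ce e - C0 := by linarith
    exact ⟨div_nonneg (by linarith) hd.le, (div_le_one hd).2 (by linarith)⟩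
  · simp

lemma attackGain_thresholdEffort_nonpos (C0 : ℝ) (Ce : E → ℝ) {pa : ℝ} (hpa : 0 < pa) (e : E) :
    attackGain C0 Ce pa (thresholdEffort C0 Ce pa) e ≤ 0 := by
  unfold attackGain thresholdEffort rhoHat
  split_ifs with hv
  · have hd : 0 < Ce e - C0 := by linarith
    rw [mul_sub, mul_div_cancel₀ _ hd.ne']
    linarith
  · linarith

/-- Moving from the threshold effort towards full protection of the vulnerable facilities makes
every attack strictly unprofitable. -/
lemma exists_attackGain_neg {C0 : ℝ} {Ce : E → ℝ} {pa : ℝ} (hpa : 0 < pa)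
    (hgen : ∀ e : E, pa ≠ Ce e - C0) {t : ℝ} (ht : 0 < t) (ht1 : t ≤ 1) :
    ∃ ρ, InBox ρ ∧ (∀ e, attackGain C0 Ce pa ρ e < 0) ∧
      ∀ e, ρ e ≤ thresholdEffort C0 Ce pa e + t := by
  refine ⟨fun e => if C0 < Ce e - pa then (1 - t) * thresholdEffort C0 Ce pa e + t else 0,
    fun e => ?_, fun e => ?_, fun e => ?_⟩ <;> have hb := thresholdEffort_inBox (C0 := C0) Ce hpa e
  · beta_reduce
    split_ifs
    · constructor <;> nlinarith
    · simp
  · have hg := attackGain_thresholdEffort_nonpos C0 Ce hpa e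
    unfold attackGain at *
    beta_reduce
    split_ifs with hv
    · nlinarith
    · have : Ce e - C0 < pa := lt_of_le_of_ne (by linarith) (hgen e).symm
      linarith
  · beta_reduce
    split_ifs
    · nlinarith
    · linarith

lemma IsBestResponse.nonneg_and_attackGain_le {C0 : ℝ} {Ce : E → ℝ} {pa : ℝ} {ρ : E → ℝ}
    {σa : Option E → ℝ} (h : IsBestResponse C0 Ce pa ρ σa) :
    0 ≤ UaRho C0 Ce pa ρ σa - C0 ∧
      ∀ e, attackGain C0 Ce pa ρ e ≤ UaRho C0 Ce pa ρ σa - C0 := by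
  refine ⟨?_, fun e => ?_⟩
  · have := h.2 _ (isAtkMixed_single none)
    rw [UaRho_single_none] at this
    linarith
  · have := h.2 _ (isAtkMixed_single (some e))
    rw [UaRho_single_some] at this
    linarith

/-- In any SPE the defender gets at least the value of exact deterrence. -/
lemma IsSPE.le_UdRho {C0 : ℝ} {Ce : E → ℝ} {pa pd : ℝ} (hpa : 0 < pa) (hpd : 0 < pd)
    (hgen : ∀ e : E, pa ≠ Ce e - C0) {ρstar : E → ℝ} {σastar : (E → ℝ) → Option E → ℝ}
    (h : IsSPE C0 Ce pa pd ρstar σastar) :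
    -C0 - pd * ∑ e, thresholdEffort C0 Ce pa e ≤ UdRho C0 Ce pd ρstar (σastar ρstar) := by
  by_contra! hlt
  set W := UdRho C0 Ce pd ρstar (σastar ρstar)
  set A := -C0 - pd * ∑ e, thresholdEffort C0 Ce pa e with hA
  have hK : 0 < pd * (Fintype.card E + 1 : ℝ) := by positivity
  obtain ⟨t, ht, htlt⟩ : ∃ t, 0 < t ∧ t < min 1 ((A - W) / (pd * (Fintype.card E + 1 : ℝ))) :=
    exists_between (lt_min one_pos (div_pos (by linarith) hK))
  obtain ⟨ρ, hρ, hneg, hle⟩ :=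
    exists_attackGain_neg hpa hgen ht (htlt.le.trans (min_le_left _ _))
  have hbr : IsBestResponse C0 Ce pa ρ (σastar ρ) := h.2.1 ρ hρ
  have hnone := hbr.none_eq_one hneg
  have hs : ∑ e, σastar ρ (some e) = 0 := by linarith [hbr.1.none_add_sum]
  have hz : ∀ e, σastar ρ (some e) = 0 := fun e =>
    (sum_eq_zero_iff_of_nonneg fun e _ => hbr.1.1 (some e)).1 hs e (mem_univ e)
  have hdev := h.2.2 ρ hρ
  rw [UdRho_eq C0 Ce pa, UaRho_eq C0 Ce pa ρ hbr.1] at hdev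
  simp only [hz, zero_mul, sum_const_zero, mul_zero, add_zero, sub_zero] at hdev
  have hsum := sum_le_sum fun e (_ : e ∈ univ) => hle e
  rw [sum_add_distrib, sum_const, card_univ, nsmul_eq_mul] at hsum
  have h1 := mul_le_mul_of_nonneg_left hsum hpd.le
  have h2 := (lt_div_iff₀ hK).1 (htlt.trans_le (min_le_right _ _))
  nlinarith [mul_pos ht hpd]

/-- **Theorem 2, type Ĩ regimes (full deterrence by proactive defense).**
Assume `V ≠ ∅`, `pa ≠ C_e − C0` for every `e`, and `∑_{e∈V} pd/(C_e−C0) < 1`. Then an SPE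
of the sequential game Γ̃ exists, and in every SPE the defender secures each vulnerable
facility with exactly the threshold effort `ρ̂_e = (C_e−pa−C0)/(C_e−C0)`, secures no other
facility, and the attacker is fully deterred on path: `σa*(∅, ρ*) = 1`. -/
theorem SPE_typeI_full_deterrence {E : Type*} [Fintype E] [DecidableEq E] [Nonempty E]
    (C0 : ℝ) (Ce : E → ℝ) (pa pd : ℝ) (hpa : 0 < pa) (hpd : 0 < pd)
    (hV : ∃ e : E, C0 < Ce e - pa)
    (hgen : ∀ e : E, pa ≠ Ce e - C0)
    (hsum : ∑ e ∈ Finset.univ.filter (fun e => C0 < Ce e - pa), pd / (Ce e - C0) < 1) :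
    (∃ (ρstar : E → ℝ) (σastar : (E → ℝ) → Option E → ℝ),
      IsSPE C0 Ce pa pd ρstar σastar) ∧
    (∀ (ρstar : E → ℝ) (σastar : (E → ℝ) → Option E → ℝ),
      IsSPE C0 Ce pa pd ρstar σastar →
        (∀ e : E, C0 < Ce e - pa → ρstar e = rhoHat C0 Ce pa e) ∧
        (∀ e : E, ¬ C0 < Ce e - pa → ρstar e = 0) ∧
        σastar ρstar none = 1) := by
  have hbound : ∀ {ρ : E → ℝ} {σa : Option E → ℝ}, InBox ρ → IsBestResponse C0 Ce pa ρ σa →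
      UdRho C0 Ce pd ρ σa + (UaRho C0 Ce pa ρ σa - C0) *
          (1 - ∑ e ∈ univ.filter (fun e => C0 < Ce e - pa), pd / (Ce e - C0)) +
        pa * ∑ e, σa (some e) ≤ -C0 - pd * ∑ e, thresholdEffort C0 Ce pa e := by
    intro ρ σa hρ h
    have := mul_sum_thresholdEffort_le hpa hpd (fun e => (hρ e).1) h.nonneg_and_attackGain_le.2
    rw [UdRho_eq C0 Ce pa]
    linarith
  refine ⟨?_, fun ρstar σastar h => ?_⟩
  · choose br hbr using exists_isBestResponse C0 Ce pa
    have hnone := isBestResponse_single_none (attackGain_thresholdEffort_nonpos C0 Ce hpa)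
    refine ⟨thresholdEffort C0 Ce pa,
      Function.update br (thresholdEffort C0 Ce pa) (Pi.single none 1),
      thresholdEffort_inBox Ce hpa, ?_⟩
    have hall : ∀ ρ, IsBestResponse C0 Ce pa ρ
        (Function.update br (thresholdEffort C0 Ce pa) (Pi.single none 1) ρ) := by
      intro ρ
      by_cases hρ : ρ = thresholdEffort C0 Ce pa
      · subst hρ; simpa using hnone
      · simpa [hρ] using hbr ρ
    refine ⟨fun ρ _ => hall ρ, fun ρ hρ => ?_⟩
    have h1 := hbound hρ (hall ρ)
    have h2 := mul_nonneg (hall ρ).nonneg_and_attackGain_le.1 (sub_nonneg.2 hsum.le)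
    have h3 := mul_nonneg hpa.le (sum_nonneg fun e (_ : e ∈ univ) => (hall ρ).1.1 (some e))
    rw [Function.update_self, UdRho_eq C0 Ce pa pd (thresholdEffort C0 Ce pa), UaRho_single_none]
    simp only [ne_eq, reduceCtorEq, not_false_eq_true, Pi.single_eq_of_ne, sum_const_zero, mul_zero,
      sub_zero]
    linarith
  · have hbr : IsBestResponse C0 Ce pa ρstar (σastar ρstar) := h.2.1 ρstar h.1
    have hlow := h.le_UdRho hpa hpd hgen
    have hup := hbound h.1 hbr
    obtain ⟨hm0, hm⟩ := hbr.nonneg_and_attackGain_le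
    have hs0 := sum_nonneg fun e (_ : e ∈ univ) => hbr.1.1 (some e)
    have hm' : UaRho C0 Ce pa ρstar (σastar ρstar) - C0 = 0 := by nlinarith
    have hs' : ∑ e, σastar ρstar (some e) = 0 := by nlinarith
    have hle : ∀ e ∈ univ, thresholdEffort C0 Ce pa e ≤ ρstar e := fun e _ => by
      simpa using thresholdEffort_le hpa e (h.1 e).1 ((hm e).trans_eq hm')
    have hsumle : ∑ e, ρstar e ≤ ∑ e, thresholdEffort C0 Ce pa e := by
      rw [UdRho_eq C0 Ce pa, hs'] at hlow
      exact le_of_mul_le_mul_left (by linarith) hpd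
    have heq := (sum_eq_sum_iff_of_le hle).1 (le_antisymm (sum_le_sum hle) hsumle)
    refine ⟨fun e he => ?_, fun e he => ?_, by linarith [hbr.1.none_add_sum]⟩
    · rw [← heq e (mem_univ e), thresholdEffort, if_pos he]
    · rw [← heq e (mem_univ e), thresholdEffort, if_neg he]

end SecGame
end
end
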